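/- arXiv:1909.04244 — 8 statements merged into one kernel-verified Lean document; each statement's English description precedes it below -/
import Mathlib

section
/- Fix an integer Δ ≥ 3. Every ζ = (β, γ, λ) ∈ ℝ³ with β > 0, γ > 0, λ ≥ 0 and (Δ−2)/Δ < √(βγ) < Δ/(Δ−2) satisfies real contraction for Δ. -/
open scoped Classical
open Finset

noncomputable section

/-- The tree recursion function `F_{ζ,s}(x) = λ β^{s₁} γ^{−s₂} ∏ᵢ (βxᵢ+1)/(xᵢ+γ)` (real). -/
def FrecR (ζ : ℝ × ℝ × ℝ) (s : ℕ × ℕ × ℕ) (x : Fin s.2.2 → ℝ) : ℝ :=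
  ζ.2.2 * ζ.1 ^ s.1 * (ζ.2.1)⁻¹ ^ s.2.1 * ∏ i, (ζ.1 * x i + 1) / (x i + ζ.2.1)
/-- `ζ = (β,γ,λ) ∈ ℝ³` satisfies real contraction for `Δ`: there are a compact interval
`J = [a,b]` with `λ ∈ J`, `−γ ∉ J`, `−1 ∉ J`, and a real analytic `φ` on `J` with
nonvanishing derivative (with inverse `ψ` on `I = φ(J)`), such that `J` is invariant
under all recursion functions with `‖s‖₁ ≤ Δ−1`, the value `−1` is avoided for
`‖s‖₁ = Δ`, and the `1`-norm of the gradient of `φ ∘ F_{ζ,s} ∘ ψ` is at most `1 − η`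
on `I^k` for some `η > 0`. -/
def RealContraction (ζ : ℝ × ℝ × ℝ) (Δ : ℕ) : Prop :=
  ∃ (a b : ℝ) (φ ψ : ℝ → ℝ) (η : ℝ),
    a ≤ b ∧ ζ.2.2 ∈ Set.Icc a b ∧ -ζ.2.1 ∉ Set.Icc a b ∧ (-1:ℝ) ∉ Set.Icc a b ∧
    AnalyticOnNhd ℝ φ (Set.Icc a b) ∧
    (∀ x ∈ Set.Icc a b, deriv φ x ≠ 0) ∧
    (∀ x ∈ Set.Icc a b, ψ (φ x) = x) ∧
    (∀ y ∈ φ '' Set.Icc a b, φ (ψ y) = y) ∧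
    (∀ s : ℕ × ℕ × ℕ, s.1 + s.2.1 + s.2.2 ≤ Δ - 1 →
      ∀ x : Fin s.2.2 → ℝ, (∀ i, x i ∈ Set.Icc a b) → FrecR ζ s x ∈ Set.Icc a b) ∧
    (∀ s : ℕ × ℕ × ℕ, s.1 + s.2.1 + s.2.2 = Δ →
      ∀ x : Fin s.2.2 → ℝ, (∀ i, x i ∈ Set.Icc a b) → FrecR ζ s x ≠ -1) ∧
    0 < η ∧
    (∀ s : ℕ × ℕ × ℕ, s.1 + s.2.1 + s.2.2 ≤ Δ - 1 →
      ∀ x : Fin s.2.2 → ℝ, (∀ i, x i ∈ φ '' Set.Icc a b) →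
        ∑ i, |deriv (fun t => φ (FrecR ζ s fun j => ψ (Function.update x i t j))) (x i)|
          ≤ 1 - η)

/-- Each factor of the recursion lies between `β` and `γ⁻¹`. -/
theorem factor_mem_Icc {β γ m M y : ℝ} (hγ : 0 < γ) (hy : 0 < y)
    (hmβ : m ≤ β) (hβM : β ≤ M) (hmγ : m ≤ γ⁻¹) (hγM : γ⁻¹ ≤ M) :
    (β * y + 1) / (y + γ) ∈ Set.Icc m M := by
  have hpos : 0 < y + γ := by positivity
  have hcancel : γ⁻¹ * γ = 1 := inv_mul_cancel₀ hγ.ne'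
  constructor
  · rw [le_div_iff₀ hpos]
    nlinarith
  · rw [div_le_iff₀ hpos]
    nlinarith

theorem FrecR_pos {β γ lam : ℝ} (hβ : 0 < β) (hγ : 0 < γ) (hlam : 0 < lam)
    (s : ℕ × ℕ × ℕ) (x : Fin s.2.2 → ℝ) (hx : ∀ i, 0 < x i) :
    0 < FrecR (β, γ, lam) s x := by
  unfold FrecR
  have : 0 < ∏ i, (β * x i + 1) / (x i + γ) := Finset.prod_pos fun i _ => by
    have := hx i
    positivity
  positivity

theorem FrecR_mem_Icc {β γ lam m M : ℝ} (hβ : 0 < β) (hγ : 0 < γ) (hlam : 0 < lam)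
    (hm : 0 < m) (hm1 : m ≤ 1) (hM1 : 1 ≤ M)
    (hmβ : m ≤ β) (hβM : β ≤ M) (hmγ : m ≤ γ⁻¹) (hγM : γ⁻¹ ≤ M) {n : ℕ}
    (s : ℕ × ℕ × ℕ) (hs : s.1 + s.2.1 + s.2.2 ≤ n)
    (x : Fin s.2.2 → ℝ) (hx : ∀ i, 0 < x i) :
    FrecR (β, γ, lam) s x ∈ Set.Icc (lam * m ^ n) (lam * M ^ n) := by
  have hfac i := factor_mem_Icc (β := β) hγ (hx i) hmβ hβM hmγ hγM
  have hfac0 i : 0 ≤ (β * x i + 1) / (x i + γ) := hm.le.trans (hfac i).1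
  have hprod0 : 0 ≤ ∏ i, (β * x i + 1) / (x i + γ) := Finset.prod_nonneg fun i _ => hfac0 i
  have hlow : m ^ s.2.2 ≤ ∏ i, (β * x i + 1) / (x i + γ) := by
    simpa using Finset.prod_le_prod (s := Finset.univ) (f := fun _ : Fin s.2.2 => m)
      (fun _ _ => hm.le) (fun i _ => (hfac i).1)
  have hup : ∏ i, (β * x i + 1) / (x i + γ) ≤ M ^ s.2.2 := by
    simpa using Finset.prod_le_prod (s := Finset.univ) (g := fun _ : Fin s.2.2 => M)
      (fun i _ => hfac0 i) (fun i _ => (hfac i).2)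
  have hM : 0 < M := hm.trans_le (hm1.trans hM1)
  unfold FrecR
  constructor
  · calc lam * m ^ n ≤ lam * m ^ (s.1 + s.2.1 + s.2.2) :=
          mul_le_mul_of_nonneg_left (pow_le_pow_of_le_one hm.le hm1 hs) hlam.le
      _ = lam * m ^ s.1 * m ^ s.2.1 * m ^ s.2.2 := by ring
      _ ≤ _ := by dsimp only; gcongr
  · calc _ ≤ lam * M ^ s.1 * M ^ s.2.1 * M ^ s.2.2 := by dsimp only; gcongr
      _ = lam * M ^ (s.1 + s.2.1 + s.2.2) := by ring
      _ ≤ lam * M ^ n := by gcongr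

/-- The logarithmic derivative of a single factor, in the coordinate `y = exp t`. -/
theorem hasDerivAt_log_factor_exp {β γ : ℝ} (hβ : 0 < β) (hγ : 0 < γ) (t : ℝ) :
    HasDerivAt (fun t => Real.log ((β * Real.exp t + 1) / (Real.exp t + γ)))
      (Real.exp t * (β * γ - 1) / ((β * Real.exp t + 1) * (Real.exp t + γ))) t := by
  have hy := Real.exp_pos t
  have h₁ : β * Real.exp t + 1 ≠ 0 := by positivity
  have h₂ : Real.exp t + γ ≠ 0 := by positivity
  have hnum := ((Real.hasDerivAt_exp t).const_mul β).add_const 1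
  have hden := (Real.hasDerivAt_exp t).add_const γ
  convert (hnum.fun_div hden h₂).log (div_ne_zero h₁ h₂) using 1
  field_simp
  ring

theorem abs_log_factor_deriv_le {β γ y : ℝ} (hβ : 0 < β) (hγ : 0 < γ) (hy : 0 < y) :
    |y * (β * γ - 1) / ((β * y + 1) * (y + γ))| ≤
      |√(β * γ) - 1| / (√(β * γ) + 1) := by
  set r := √(β * γ)
  have hr : 0 ≤ r := Real.sqrt_nonneg _
  have hrr : r * r = β * γ := Real.mul_self_sqrt (by positivity)
  have hden : 0 < (β * y + 1) * (y + γ) := by positivity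
  have hamgm : 2 * r * y ≤ β * y ^ 2 + γ := by
    apply le_of_mul_le_mul_left _ hβ
    nlinarith [sq_nonneg (β * y - r)]
  rw [← hrr, abs_div, abs_of_pos hden, abs_mul, abs_of_pos hy,
    show r * r - 1 = (r - 1) * (r + 1) by ring, abs_mul,
    abs_of_nonneg (by positivity : 0 ≤ r + 1), div_le_div_iff₀ hden (by positivity)]
  have key : y * ((r + 1) * (r + 1)) ≤ (β * y + 1) * (y + γ) := by nlinarith
  calc y * (|r - 1| * (r + 1)) * (r + 1) = |r - 1| * (y * ((r + 1) * (r + 1))) := by ring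
    _ ≤ _ := mul_le_mul_of_nonneg_left key (abs_nonneg _)

theorem hasDerivAt_log_FrecR_exp {β γ lam : ℝ} (hβ : 0 < β) (hγ : 0 < γ) (hlam : 0 < lam)
    (s : ℕ × ℕ × ℕ) (x : Fin s.2.2 → ℝ) (i : Fin s.2.2) :
    HasDerivAt
      (fun t => Real.log (FrecR (β, γ, lam) s fun j => Real.exp (Function.update x i t j)))
      (Real.exp (x i) * (β * γ - 1) / ((β * Real.exp (x i) + 1) * (Real.exp (x i) + γ)))
      (x i) := by
  set g : ℝ → ℝ := fun t => Real.log ((β * Real.exp t + 1) / (Real.exp t + γ))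
  have hsplit : (fun t =>
      Real.log (FrecR (β, γ, lam) s fun j => Real.exp (Function.update x i t j))) =
      fun t => Real.log (lam * β ^ s.1 * γ⁻¹ ^ s.2.1) +
        (g t + ∑ j ∈ Finset.univ \ {i}, g (x j)) := by
    funext t
    have hfac j : (β * Real.exp (Function.update x i t j) + 1) /
        (Real.exp (Function.update x i t j) + γ) ≠ 0 := by positivity
    have hsum := Finset.sum_update_of_mem (Finset.mem_univ i) (fun j => g (x j)) (g t)
    rw [← hsum]
    simp only [FrecR]
    rw [Real.log_mul (by positivity) (Finset.prod_ne_zero_iff.mpr fun j _ => hfac j),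
      Real.log_prod fun j _ => hfac j]
    congr 1
    refine Finset.sum_congr rfl fun j _ => ?_
    exact Function.apply_update (fun _ => g) x i t j
  rw [hsplit]
  exact ((hasDerivAt_log_factor_exp hβ hγ (x i)).add_const _).const_add _

theorem natCast_mul_abs_sub_one_div_lt_one {Δ : ℕ} (hΔ : 3 ≤ Δ) {r : ℝ} (hr : 0 ≤ r)
    (h1 : ((Δ : ℝ) - 2) / (Δ : ℝ) < r) (h2 : r < (Δ : ℝ) / ((Δ : ℝ) - 2)) :
    ((Δ - 1 : ℕ) : ℝ) * (|r - 1| / (r + 1)) < 1 := by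
  have hΔ' : (3 : ℝ) ≤ Δ := by exact_mod_cast hΔ
  rw [div_lt_iff₀ (by linarith)] at h1
  rw [lt_div_iff₀ (by linarith)] at h2
  rw [Nat.cast_sub (by omega), Nat.cast_one, ← mul_div_assoc, div_lt_one (by positivity)]
  rcases abs_cases (r - 1) with ⟨h, _⟩ | ⟨h, _⟩ <;> rw [h] <;> nlinarith

theorem realContraction_of_activity_eq_zero {β γ : ℝ} (hγ : 0 < γ) (Δ : ℕ) :
    RealContraction (β, γ, 0) Δ := by
  have hF (s : ℕ × ℕ × ℕ) (x : Fin s.2.2 → ℝ) : FrecR (β, γ, 0) s x = 0 := by simp [FrecR]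
  refine ⟨0, 0, id, id, 1, le_rfl, by simp, by simp [hγ.ne'], by simp, analyticOnNhd_id,
    by simp, by simp, by simp, fun s _ x _ => by simp [hF], fun s _ x _ => by simp [hF],
    one_pos, fun s _ x _ => ?_⟩
  simp [hF]

/-- For `Δ ≥ 3`, every `ζ = (β, γ, λ) ∈ ℝ³` with `β, γ > 0`, `λ ≥ 0`
and `(Δ−2)/Δ < √(βγ) < Δ/(Δ−2)` satisfies real contraction for `Δ`. -/
theorem S1_realContraction (Δ : ℕ) (hΔ : 3 ≤ Δ) (β γ lam : ℝ)
    (hβ : 0 < β) (hγ : 0 < γ) (hlam : 0 ≤ lam)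
    (h1 : ((Δ:ℝ) - 2) / (Δ:ℝ) < Real.sqrt (β * γ))
    (h2 : Real.sqrt (β * γ) < (Δ:ℝ) / ((Δ:ℝ) - 2)) :
    RealContraction (β, γ, lam) Δ := by
  rcases hlam.eq_or_lt with rfl | hlam
  · exact realContraction_of_activity_eq_zero hγ Δ
  have hγi : 0 < γ⁻¹ := inv_pos.mpr hγ
  set m := min 1 (min β γ⁻¹)
  set M := max 1 (max β γ⁻¹)
  have hm : 0 < m := lt_min one_pos (lt_min hβ hγi)
  have hm1 : m ≤ 1 := min_le_left _ _
  have hmβ : m ≤ β := (min_le_right _ _).trans (min_le_left _ _)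
  have hmγ : m ≤ γ⁻¹ := (min_le_right _ _).trans (min_le_right _ _)
  have hM1 : 1 ≤ M := le_max_left _ _
  have hβM : β ≤ M := (le_max_left _ _).trans (le_max_right _ _)
  have hγM : γ⁻¹ ≤ M := (le_max_right _ _).trans (le_max_right _ _)
  have hlamJ : lam ∈ Set.Icc (lam * m ^ (Δ - 1)) (lam * M ^ (Δ - 1)) :=
    ⟨mul_le_of_le_one_right hlam.le (pow_le_one₀ hm.le hm1),
      le_mul_of_one_le_right hlam.le (one_le_pow₀ hM1)⟩
  have hJ : ∀ y ∈ Set.Icc (lam * m ^ (Δ - 1)) (lam * M ^ (Δ - 1)), 0 < y :=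
    fun y hy => lt_of_lt_of_le (by positivity) hy.1
  refine ⟨_, _, Real.log, Real.exp,
    1 - ((Δ - 1 : ℕ) : ℝ) * (|√(β * γ) - 1| / (√(β * γ) + 1)),
    hlamJ.1.trans hlamJ.2, hlamJ, fun h => ?_, fun h => ?_, fun y hy => ?_, fun y hy => ?_,
    fun y hy => Real.exp_log (hJ y hy), fun y _ => Real.log_exp y,
    fun s hs x hx => FrecR_mem_Icc hβ hγ hlam hm hm1 hM1 hmβ hβM hmγ hγM s hs x
      fun i => hJ _ (hx i), fun s _ x hx => ?_,
    sub_pos.mpr (natCast_mul_abs_sub_one_div_lt_one hΔ (Real.sqrt_nonneg _) h1 h2),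
    fun s hs x _ => ?_⟩
  · linarith [show 0 < -γ from hJ _ h]
  · linarith [hJ _ h]
  · exact analyticAt_log (hJ y hy)
  · rw [Real.deriv_log]
    exact inv_ne_zero (hJ y hy).ne'
  · linarith [FrecR_pos hβ hγ hlam s x fun i => hJ _ (hx i)]
  · rw [sub_sub_cancel]
    calc _ ≤ ∑ _i : Fin s.2.2, |√(β * γ) - 1| / (√(β * γ) + 1) :=
          Finset.sum_le_sum fun i _ => by
            rw [(hasDerivAt_log_FrecR_exp hβ hγ hlam s x i).deriv]
            exact abs_log_factor_deriv_le hβ hγ (Real.exp_pos _)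
      _ = (s.2.2 : ℝ) * (|√(β * γ) - 1| / (√(β * γ) + 1)) := by simp
      _ ≤ _ := by
        gcongr
        omega
end
end

section
/- Fix an integer Δ ≥ 3. Every ζ = (β, γ, λ) ∈ ℝ³ with βγ < 1, β ≥ 0, γ > 0, λ ≥ 0 that is up-to-Δ unique satisfies real contraction for Δ. (When β = 0 the contraction conditions are required only for recursion functions F_{ζ,s} with s₁ = 0.) -/
open scoped Classical
open Finset

noncomputable section

/-- `ζ = (β,γ,λ)` with `βγ < 1`, `β ≥ 0`, `γ > 0`, `λ ≥ 0` is up-to-`Δ` unique: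
either `λ = 0`, or `λ > 0` and there is a constant `0 < c < 1` such that for every
`1 ≤ d ≤ Δ−1` and every positive fixed point `x̂` of `f_d(x) = λ((βx+1)/(x+γ))^d`
(such a fixed point exists and is unique), `d(1−βγ)x̂/((βx̂+1)(x̂+γ)) ≤ c`. -/
def UpToUnique (ζ : ℝ × ℝ × ℝ) (Δ : ℕ) : Prop :=
  ζ.2.2 = 0 ∨
    (0 < ζ.2.2 ∧ ∃ c : ℝ, 0 < c ∧ c < 1 ∧
      ∀ d : ℕ, 1 ≤ d → d ≤ Δ - 1 →
        ∀ x : ℝ, 0 < x → ζ.2.2 * ((ζ.1 * x + 1) / (x + ζ.2.1)) ^ d = x →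
          (d : ℝ) * (1 - ζ.1 * ζ.2.1) * x / ((ζ.1 * x + 1) * (x + ζ.2.1)) ≤ c)

/-- Real contraction for `Δ`, where (as in the paper) when `β = 0` the contraction
conditions are required only for the recursion functions `F_{ζ,s}` with `s₁ = 0`;
when `β ≠ 0` this is exactly real contraction. -/
def RealContractionRestr (ζ : ℝ × ℝ × ℝ) (Δ : ℕ) : Prop :=
  ∃ (a b : ℝ) (φ ψ : ℝ → ℝ) (η : ℝ),
    a ≤ b ∧ ζ.2.2 ∈ Set.Icc a b ∧ -ζ.2.1 ∉ Set.Icc a b ∧ (-1:ℝ) ∉ Set.Icc a b ∧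
    AnalyticOnNhd ℝ φ (Set.Icc a b) ∧
    (∀ x ∈ Set.Icc a b, deriv φ x ≠ 0) ∧
    (∀ x ∈ Set.Icc a b, ψ (φ x) = x) ∧
    (∀ y ∈ φ '' Set.Icc a b, φ (ψ y) = y) ∧
    (∀ s : ℕ × ℕ × ℕ, (ζ.1 = 0 → s.1 = 0) → s.1 + s.2.1 + s.2.2 ≤ Δ - 1 →
      ∀ x : Fin s.2.2 → ℝ, (∀ i, x i ∈ Set.Icc a b) → FrecR ζ s x ∈ Set.Icc a b) ∧
    (∀ s : ℕ × ℕ × ℕ, (ζ.1 = 0 → s.1 = 0) → s.1 + s.2.1 + s.2.2 = Δ →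
      ∀ x : Fin s.2.2 → ℝ, (∀ i, x i ∈ Set.Icc a b) → FrecR ζ s x ≠ -1) ∧
    0 < η ∧
    (∀ s : ℕ × ℕ × ℕ, (ζ.1 = 0 → s.1 = 0) → s.1 + s.2.1 + s.2.2 ≤ Δ - 1 →
      ∀ x : Fin s.2.2 → ℝ, (∀ i, x i ∈ φ '' Set.Icc a b) →
        ∑ i, |deriv (fun t => φ (FrecR ζ s fun j => ψ (Function.update x i t j))) (x i)|
          ≤ 1 - η)

/-- A function with monotone derivative lies above its tangent lines. -/
lemma tangent_le_of_monotone_deriv {S σ : ℝ → ℝ} (hS : ∀ x, HasDerivAt S (σ x) x)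
    (hσ : Monotone σ) (x y : ℝ) : S x + σ x * (y - x) ≤ S y := by
  have hconv : ConvexOn ℝ Set.univ S :=
    Monotone.convexOn_univ_of_deriv (fun z => (hS z).differentiableAt)
      (by rwa [show deriv S = σ from funext fun z => (hS z).deriv])
  rcases lt_trichotomy x y with h | rfl | h
  · have := hconv.le_slope_of_hasDerivAt (Set.mem_univ x) (Set.mem_univ y) h (hS x)
    rw [slope_def_field, le_div_iff₀ (by linarith)] at this
    linarith
  · simp
  · have := hconv.slope_le_of_hasDerivAt (Set.mem_univ y) (Set.mem_univ x) h (hS x)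
    rw [slope_def_field, div_le_iff₀ (by linarith)] at this
    linarith

/-- Two-point estimate: if `S` is convex, `V' = -D exp (-S)` and `D < exp S` holds with a margin at
a fixed point of `V` where `S` is nondecreasing, then `D²` is at most `exp (S u + S (V u))` with the
same margin. -/
lemma sq_le_mul_exp_of_fixedPoint_of_nonneg {S σ V : ℝ → ℝ} {D c p : ℝ}
    (hS : ∀ x, HasDerivAt S (σ x) x) (hσ : Monotone σ)
    (hV : ∀ x, HasDerivAt V (-(D / Real.exp (S x))) x) (hD : 0 < D) (hc0 : 0 < c) (hc1 : c < 1)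
    (hp : V p = p) (hDp : D ≤ c * Real.exp (S p)) (hσp : 0 ≤ σ p) (u : ℝ) :
    D ^ 2 ≤ c * (Real.exp (S u) * Real.exp (S (V u))) := by
  have htan := tangent_le_of_monotone_deriv hS hσ
  have hanti : Antitone V := antitone_of_hasDerivAt_nonpos hV fun x => by
    have := Real.exp_pos (S x)
    have : 0 ≤ D / Real.exp (S x) := by positivity
    simpa using this
  have hVdiff : Differentiable ℝ V := fun x => (hV x).differentiableAt
  have hDp' : D < Real.exp (S p) :=
    hDp.trans_lt (by nlinarith [Real.exp_pos (S p)])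
  have hexp : ∀ {x y : ℝ}, x ≤ y → Real.exp x ≤ Real.exp y := fun h => Real.exp_le_exp.mpr h
  have hmonoS : ∀ x, p ≤ x → S p ≤ S x := fun x hx =>
    le_trans (by nlinarith [mul_nonneg hσp (sub_nonneg.mpr hx)]) (htan p x)
  rcases le_total u p with hup | hup
  · have hpv : p ≤ V u := hp ▸ hanti hup
    have hDv : D ≤ c * Real.exp (S (V u)) :=
      hDp.trans (mul_le_mul_of_nonneg_left (hexp (hmonoS _ hpv)) hc0.le)
    rcases le_total D (Real.exp (S u)) with hDu | hDu
    · nlinarith [mul_le_mul hDu hDv hD.le (Real.exp_pos _).le]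
    · have hScont : Continuous fun x => Real.exp (S x) :=
        Real.continuous_exp.comp
          (Differentiable.continuous fun x => (hS x).differentiableAt)
      obtain ⟨w, ⟨huw, hwp⟩, hw⟩ :=
        intermediate_value_Icc hup hScont.continuousOn ⟨hDu, hDp'.le⟩
      simp only at hw
      have hpw : p ≤ V w := hp ▸ hanti hwp
      have hle : ∀ x ∈ Set.Icc u w, Real.exp (S x) ≤ D := by
        have hconv : ConvexOn ℝ Set.univ S :=
          Monotone.convexOn_univ_of_deriv (fun z => (hS z).differentiableAt)
            (by rwa [show deriv S = σ from funext fun z => (hS z).deriv])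
        intro x hx
        have := hconv.le_max_of_mem_Icc (Set.mem_univ u) (Set.mem_univ w) hx
        rcases le_max_iff.mp this with h | h
        · exact (hexp h).trans hDu
        · exact (hexp h).trans hw.le
      have hVsub : w - u ≤ V u - V w := by
        have := (convex_Icc u w).image_sub_le_mul_sub_of_deriv_le (f := V) (C := -1)
          hVdiff.continuous.continuousOn hVdiff.differentiableOn
          (fun x hx => by
            rw [(hV x).deriv, neg_le_neg_iff, one_le_div (Real.exp_pos _)]
            exact hle x (interior_subset hx))
          u (Set.left_mem_Icc.mpr huw) w (Set.right_mem_Icc.mpr huw) huw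
        linarith
      have h1 := htan (V w) (V u)
      have h2 := htan w u
      have h3 : σ w ≤ σ (V w) := hσ (hwp.trans hpw)
      have h4 : 0 ≤ σ (V w) := hσp.trans (hσ hpw)
      have hsum : S w + S (V w) ≤ S u + S (V u) := by
        nlinarith [mul_le_mul_of_nonneg_left hVsub h4,
          mul_le_mul_of_nonneg_right h3 (sub_nonneg.mpr huw)]
      have hDw : D ≤ c * Real.exp (S (V w)) :=
        hDp.trans (mul_le_mul_of_nonneg_left (hexp (hmonoS _ hpw)) hc0.le)
      calc D ^ 2 ≤ c * (Real.exp (S w) * Real.exp (S (V w))) := by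
            rw [hw]; nlinarith
        _ ≤ _ := by
            rw [← Real.exp_add, ← Real.exp_add]
            exact mul_le_mul_of_nonneg_left (hexp hsum) hc0.le
  · have hvp : V u ≤ p := hp ▸ hanti hup
    have hVsub : V p - V u ≤ u - p := by
      have := (convex_Icc p u).mul_sub_le_image_sub_of_le_deriv (f := V) (C := -1)
        hVdiff.continuous.continuousOn hVdiff.differentiableOn
        (fun x hx => by
          rw [(hV x).deriv, neg_le_neg_iff, div_le_one (Real.exp_pos _)]
          exact hDp'.le.trans (hexp (hmonoS x (interior_subset hx).1)))
        p (Set.left_mem_Icc.mpr hup) u (Set.right_mem_Icc.mpr hup) hup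
      linarith
    rw [hp] at hVsub
    have h1 := htan p u
    have h2 := htan p (V u)
    have hsum : S p + S p ≤ S u + S (V u) := by
      nlinarith [mul_le_mul_of_nonneg_left hVsub hσp]
    calc D ^ 2 ≤ c * (Real.exp (S p) * Real.exp (S p)) := by
          nlinarith [Real.exp_pos (S p)]
      _ ≤ _ := by
          rw [← Real.exp_add, ← Real.exp_add]
          exact mul_le_mul_of_nonneg_left (hexp hsum) hc0.le

/-- Version of `sq_le_mul_exp_of_fixedPoint_of_nonneg` without a sign condition on `S'`. -/
lemma sq_le_mul_exp_of_fixedPoint {S σ V : ℝ → ℝ} {D c p : ℝ}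
    (hS : ∀ x, HasDerivAt S (σ x) x) (hσ : Monotone σ)
    (hV : ∀ x, HasDerivAt V (-(D / Real.exp (S x))) x) (hD : 0 < D) (hc0 : 0 < c) (hc1 : c < 1)
    (hp : V p = p) (hDp : D ≤ c * Real.exp (S p)) (u : ℝ) :
    D ^ 2 ≤ c * (Real.exp (S u) * Real.exp (S (V u))) := by
  rcases le_total 0 (σ p) with h | h
  · exact sq_le_mul_exp_of_fixedPoint_of_nonneg hS hσ hV hD hc0 hc1 hp hDp h u
  · have := sq_le_mul_exp_of_fixedPoint_of_nonneg (S := fun x => S (-x)) (σ := fun x => -σ (-x))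
      (V := fun x => -V (-x)) (D := D) (c := c) (p := -p)
      (fun x => by simpa [Function.comp_def] using (hS (-x)).comp x (hasDerivAt_neg x))
      (fun x y hxy => neg_le_neg (hσ (neg_le_neg hxy)))
      (fun x => by
        simpa [Function.comp_def, Pi.neg_def] using ((hV (-x)).comp x (hasDerivAt_neg x)).neg)
      hD hc0 hc1 (by simp [hp]) (by simpa using hDp) (by simpa using h) (-u)
    simpa using this

/-- The map `x ↦ λ ((βx+1)/(x+γ))^d` has a positive fixed point. -/
lemma exists_pos_fixedPoint {β γ lam : ℝ} (hβ : 0 ≤ β) (hγ : 0 < γ) (hlam : 0 < lam)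
    (hβγ : β * γ < 1) (d : ℕ) : ∃ x : ℝ, 0 < x ∧ lam * ((β * x + 1) / (x + γ)) ^ d = x := by
  have hB : 0 < lam * (1 / γ) ^ d := by positivity
  have hcont : ContinuousOn (fun x : ℝ => lam * ((β * x + 1) / (x + γ)) ^ d - x)
      (Set.Icc 0 (lam * (1 / γ) ^ d)) := by
    refine ContinuousOn.sub (continuousOn_const.mul (ContinuousOn.pow ?_ d)) continuousOn_id
    refine ContinuousOn.div (by fun_prop) (by fun_prop) fun x hx => ?_
    have := hx.1
    positivity
  obtain ⟨x, hx, hx0⟩ := intermediate_value_Icc' hB.le hcont (show (0 : ℝ) ∈ _ by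
    constructor
    · have hle : (β * (lam * (1 / γ) ^ d) + 1) / (lam * (1 / γ) ^ d + γ) ≤ 1 / γ := by
        rw [div_le_div_iff₀ (by positivity) hγ]
        nlinarith [mul_pos hB (sub_pos.mpr hβγ)]
      have := mul_le_mul_of_nonneg_left (pow_le_pow_left₀ (by positivity) hle d) hlam.le
      simpa using this
    · simpa using hB.le)
  have hfix : lam * ((β * x + 1) / (x + γ)) ^ d = x := by simpa [sub_eq_zero] using hx0
  have h0 : 0 ≤ x := hx.1
  exact ⟨x, by rw [← hfix]; positivity, hfix⟩

/-- If the slope of `x ↦ λ ((βx+1)/(x+γ))^d` in logarithmic coordinates is at most `c < 1` in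
absolute value at positive fixed points, then the product of the slopes at two consecutive points
of any orbit is at most `c`. -/
lemma sq_mul_le_of_fixedPoint_slope_le {β γ lam c : ℝ} (hβ : 0 ≤ β) (hγ : 0 < γ) (hlam : 0 < lam)
    (hβγ : β * γ < 1) {d : ℕ} (hd : 1 ≤ d) (hc0 : 0 < c) (hc1 : c < 1)
    (hfix : ∀ x : ℝ, 0 < x → lam * ((β * x + 1) / (x + γ)) ^ d = x →
      (d : ℝ) * (1 - β * γ) * x / ((β * x + 1) * (x + γ)) ≤ c)
    {x y : ℝ} (hx : 0 < x) (hy : lam * ((β * x + 1) / (x + γ)) ^ d = y) :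
    (d : ℝ) ^ 2 * (((1 - β * γ) ^ 2 * x / ((β * x + 1) * (x + γ))) *
      (y / ((β * y + 1) * (y + γ)))) ≤ c := by
  obtain ⟨p, hp, hpfix⟩ := exists_pos_fixedPoint hβ hγ hlam hβγ d
  have hpc := hfix p hp hpfix
  set S : ℝ → ℝ := fun u => Real.log (β * Real.exp u + 1) + Real.log (1 + γ * Real.exp (-u))
    with hSdef
  set V : ℝ → ℝ := fun u =>
    Real.log lam + d * (Real.log (β * Real.exp u + 1) - Real.log (Real.exp u + γ)) with hVdef
  have hSexp : ∀ u, Real.exp (S u) = (β * Real.exp u + 1) * (1 + γ * Real.exp (-u)) := fun u => by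
    rw [hSdef, Real.exp_add, Real.exp_log (by positivity), Real.exp_log (by positivity)]
  have hSlog : ∀ {t : ℝ}, 0 < t → Real.exp (S (Real.log t)) = (β * t + 1) * (t + γ) / t := by
    intro t ht
    rw [hSexp, Real.exp_neg, Real.exp_log ht]
    field_simp
  have hVlog : ∀ {t : ℝ}, 0 < t → V (Real.log t) = Real.log (lam * ((β * t + 1) / (t + γ)) ^ d) := by
    intro t ht
    have : 0 < (β * t + 1) / (t + γ) := by positivity
    rw [Real.log_mul hlam.ne' (by positivity), Real.log_pow,
      Real.log_div (by positivity) (by positivity)]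
    simp only [hVdef, Real.exp_log ht]
  have hd0 : (0 : ℝ) < d := by exact_mod_cast hd
  have hK : 0 < 1 - β * γ := by linarith
  have hS : ∀ u, HasDerivAt S ((1 + γ * Real.exp (-u))⁻¹ - (β * Real.exp u + 1)⁻¹) u := by
    intro u
    have h1 : HasDerivAt (fun u => β * Real.exp u + 1) (β * Real.exp u) u :=
      ((Real.hasDerivAt_exp u).const_mul β).add_const 1
    have h2 : HasDerivAt (fun u => 1 + γ * Real.exp (-u)) (γ * (Real.exp (-u) * -1)) u :=
      (((hasDerivAt_neg u).exp).const_mul γ).const_add 1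
    have e1 : β * Real.exp u + 1 ≠ 0 := by positivity
    have e2 : 1 + γ * Real.exp (-u) ≠ 0 := by positivity
    refine ((h1.log e1).add (h2.log e2)).congr_deriv ?_
    field_simp
    ring
  have hσ : Monotone fun u => (1 + γ * Real.exp (-u))⁻¹ - (β * Real.exp u + 1)⁻¹ := by
    intro u v huv
    have h1 : Real.exp u ≤ Real.exp v := Real.exp_le_exp.mpr huv
    have h2 : Real.exp (-v) ≤ Real.exp (-u) := Real.exp_le_exp.mpr (by linarith)
    have h3 : (1 + γ * Real.exp (-u))⁻¹ ≤ (1 + γ * Real.exp (-v))⁻¹ := by gcongr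
    have h4 : (β * Real.exp v + 1)⁻¹ ≤ (β * Real.exp u + 1)⁻¹ := by gcongr
    simp only
    linarith
  have hV : ∀ u, HasDerivAt V (-((d * (1 - β * γ)) / Real.exp (S u))) u := by
    intro u
    have h1 : HasDerivAt (fun u => β * Real.exp u + 1) (β * Real.exp u) u :=
      ((Real.hasDerivAt_exp u).const_mul β).add_const 1
    have h2 : HasDerivAt (fun u => Real.exp u + γ) (Real.exp u) u :=
      (Real.hasDerivAt_exp u).add_const γ
    have e1 : β * Real.exp u + 1 ≠ 0 := by positivity
    have e2 : Real.exp u + γ ≠ 0 := by positivity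
    refine ((((h1.log e1).sub (h2.log e2)).const_mul (d : ℝ)).const_add
      (Real.log lam)).congr_deriv ?_
    rw [hSexp, Real.exp_neg]
    have e3 := (Real.exp_pos u).ne'
    field_simp
    ring
  have hy0 : 0 < y := by rw [← hy]; positivity
  have key := sq_le_mul_exp_of_fixedPoint hS hσ hV (by positivity) hc0 hc1
    (p := Real.log p) (by rw [hVlog hp, hpfix])
    (by
      rw [hSlog hp]
      rw [div_le_iff₀ (by positivity)] at hpc
      rw [← mul_div_assoc, le_div_iff₀ hp]
      exact hpc) (Real.log x)
  rw [hVlog hx, hy, hSlog hx, hSlog hy0] at key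
  have : (d : ℝ) ^ 2 * (((1 - β * γ) ^ 2 * x / ((β * x + 1) * (x + γ))) *
      (y / ((β * y + 1) * (y + γ)))) =
      (d * (1 - β * γ)) ^ 2 / ((β * x + 1) * (x + γ) / x * ((β * y + 1) * (y + γ) / y)) := by
    field_simp
  rw [this, div_le_iff₀ (by positivity)]
  exact key

/-- The arithmetic-geometric mean inequality in terms of an `n`-th root of the product. -/
lemma card_mul_le_sum_of_pow_eq_prod {ι : Type*} [Fintype ι] [Nonempty ι] {z : ι → ℝ}
    (hz : ∀ i, 0 < z i) {Z : ℝ} (hZ : 0 < Z) (hprod : Z ^ Fintype.card ι = ∏ i, z i) :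
    Fintype.card ι * Z ≤ ∑ i, z i := by
  have hn : (0 : ℝ) < Fintype.card ι := by exact_mod_cast Fintype.card_pos
  have := Real.geom_mean_le_arith_mean univ (fun _ => 1) z (by simp) (by simpa using hn)
    (fun i _ => (hz i).le)
  simp only [Real.rpow_one, sum_const, card_univ, nsmul_eq_mul, mul_one, one_mul, ← hprod] at this
  rw [Real.pow_rpow_inv_natCast hZ.le Fintype.card_ne_zero, le_div_iff₀ hn] at this
  linarith

/-- Concavity of `z ↦ √((1 - γz)(1 - β/z))` in `log z`, in the form of Jensen's inequality. -/
lemma exists_geomMean_sum_sqrt_sq_le {ι : Type*} [Fintype ι] [Nonempty ι] {β γ : ℝ} {z : ι → ℝ}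
    (hβ : 0 ≤ β) (hγ : 0 < γ) (hz : ∀ i, 0 < z i) (hzβ : ∀ i, β ≤ z i) (hzγ : ∀ i, γ * z i ≤ 1) :
    ∃ Z : ℝ, 0 < Z ∧ Z ^ Fintype.card ι = ∏ i, z i ∧ β ≤ Z ∧ γ * Z ≤ 1 ∧
      (∑ i, √((1 - γ * z i) * (1 - β / z i))) ^ 2 ≤
        (Fintype.card ι : ℝ) ^ 2 * ((1 - γ * Z) * (1 - β / Z)) := by
  have hn : (0 : ℝ) < Fintype.card ι := by exact_mod_cast Fintype.card_pos
  have hP : 0 < ∏ i, z i := prod_pos fun i _ => hz i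
  set Z : ℝ := (∏ i, z i) ^ ((Fintype.card ι : ℝ)⁻¹) with hZdef
  have hZ : 0 < Z := Real.rpow_pos_of_pos hP _
  have hprod : Z ^ Fintype.card ι = ∏ i, z i :=
    Real.rpow_inv_natCast_pow hP.le Fintype.card_ne_zero
  have hA := card_mul_le_sum_of_pow_eq_prod hz hZ hprod
  have hB := card_mul_le_sum_of_pow_eq_prod (z := fun i => (z i)⁻¹) (fun i => inv_pos.mpr (hz i))
    (inv_pos.mpr hZ) (by rw [inv_pow, hprod, prod_inv_distrib])
  have hsumA : ∑ i, (1 - γ * z i) ≤ Fintype.card ι * (1 - γ * Z) := by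
    rw [sum_sub_distrib, ← mul_sum]
    simp only [sum_const, card_univ, nsmul_eq_mul, mul_one]
    nlinarith [mul_le_mul_of_nonneg_left hA hγ.le]
  have hsumB : ∑ i, (1 - β / z i) ≤ Fintype.card ι * (1 - β / Z) := by
    simp only [div_eq_mul_inv]
    rw [sum_sub_distrib, ← mul_sum]
    simp only [sum_const, card_univ, nsmul_eq_mul, mul_one]
    nlinarith [mul_le_mul_of_nonneg_left hB hβ]
  have hA0 : ∀ i, 0 ≤ 1 - γ * z i := fun i => sub_nonneg.mpr (hzγ i)
  have hB0 : ∀ i, 0 ≤ 1 - β / z i := fun i => sub_nonneg.mpr ((div_le_one (hz i)).mpr (hzβ i))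
  have hA1 : 0 ≤ ∑ i, (1 - γ * z i) := sum_nonneg fun i _ => hA0 i
  have hB1 : 0 ≤ ∑ i, (1 - β / z i) := sum_nonneg fun i _ => hB0 i
  refine ⟨Z, hZ, hprod, ?_, ?_, ?_⟩
  · have := nonneg_of_mul_nonneg_right (hB1.trans hsumB) hn
    exact (div_le_one hZ).mp (sub_nonneg.mp this)
  · have := nonneg_of_mul_nonneg_right (hA1.trans hsumA) hn
    linarith
  · calc (∑ i, √((1 - γ * z i) * (1 - β / z i))) ^ 2
        = (∑ i, √(1 - γ * z i) * √(1 - β / z i)) ^ 2 := by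
          simp only [Real.sqrt_mul (hA0 _)]
      _ ≤ (∑ i, √(1 - γ * z i) ^ 2) * ∑ i, √(1 - β / z i) ^ 2 := sum_mul_sq_le_sq_mul_sq _ _ _
      _ = (∑ i, (1 - γ * z i)) * ∑ i, (1 - β / z i) := by
          simp only [Real.sq_sqrt (hA0 _), Real.sq_sqrt (hB0 _)]
      _ ≤ (Fintype.card ι * (1 - γ * Z)) * (Fintype.card ι * (1 - β / Z)) :=
          mul_le_mul hsumA hsumB hB1 (hA1.trans hsumA)
      _ = _ := by ring

/-- The factors of `FrecR`: those of the two pinned types, then the ratios at the arguments. -/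
def recFactor (β γ : ℝ) (s : ℕ × ℕ × ℕ) (x : Fin s.2.2 → ℝ) :
    Fin s.1 ⊕ Fin s.2.1 ⊕ Fin s.2.2 → ℝ :=
  Sum.elim (fun _ => β) (Sum.elim (fun _ => γ⁻¹) fun i => (β * x i + 1) / (x i + γ))

lemma frecR_eq_mul_prod (β γ lam : ℝ) (s : ℕ × ℕ × ℕ) (x : Fin s.2.2 → ℝ) :
    FrecR (β, γ, lam) s x = lam * ∏ i, recFactor β γ s x i := by
  simp [FrecR, recFactor, Fintype.prod_sum_type, mul_assoc]

lemma le_ratio {β γ x : ℝ} (hγ : 0 < γ) (hβγ : β * γ < 1) (hx : 0 ≤ x) :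
    β ≤ (β * x + 1) / (x + γ) := by
  rw [le_div_iff₀ (by positivity)]
  nlinarith

lemma ratio_le {β γ x : ℝ} (hγ : 0 < γ) (hβγ : β * γ < 1) (hx : 0 ≤ x) :
    (β * x + 1) / (x + γ) ≤ γ⁻¹ := by
  rw [div_le_iff₀ (by positivity), inv_mul_eq_div, le_div_iff₀ hγ]
  nlinarith

/-- A bound valid for the pinned factors and for the ratios is valid for all of `recFactor`. -/
lemma forall_recFactor {β γ : ℝ} {s : ℕ × ℕ × ℕ} {x : Fin s.2.2 → ℝ} {p : ℝ → Prop}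
    (hs : β = 0 → s.1 = 0) (h1 : β ≠ 0 → p β) (h2 : p γ⁻¹)
    (h3 : ∀ i, p ((β * x i + 1) / (x i + γ))) : ∀ i, p (recFactor β γ s x i) := by
  rintro (i | i | i)
  · refine h1 fun h => ?_
    have := i.2
    have := hs h
    omega
  · exact h2
  · exact h3 i

/-- The recursion function contracts in the metric `dx / √(x(βx+1)(x+γ))`. -/
lemma sum_sqrt_mul_sqrt_frecR_le {Δ : ℕ} {β γ lam c : ℝ} (hβ : 0 ≤ β) (hγ : 0 < γ)
    (hlam : 0 < lam) (hβγ : β * γ < 1) (hc0 : 0 < c) (hc1 : c < 1)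
    (hfix : ∀ d : ℕ, 1 ≤ d → d ≤ Δ - 1 →
      ∀ x : ℝ, 0 < x → lam * ((β * x + 1) / (x + γ)) ^ d = x →
        (d : ℝ) * (1 - β * γ) * x / ((β * x + 1) * (x + γ)) ≤ c)
    {s : ℕ × ℕ × ℕ} (hs : β = 0 → s.1 = 0) (hsΔ : s.1 + s.2.1 + s.2.2 ≤ Δ - 1)
    {x : Fin s.2.2 → ℝ} (hx : ∀ i, 0 < x i) {F : ℝ} (hF : FrecR (β, γ, lam) s x = F) :
    (∑ i, (1 - β * γ) * √(x i / ((β * x i + 1) * (x i + γ)))) *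
      √(F / ((β * F + 1) * (F + γ))) ≤ √c := by
  rcases Nat.eq_zero_or_pos s.2.2 with hk | hk
  · have : IsEmpty (Fin s.2.2) := by rw [hk]; infer_instance
    simp
  have hK : 0 < 1 - β * γ := by linarith
  have hne : Nonempty (Fin s.1 ⊕ Fin s.2.1 ⊕ Fin s.2.2) := ⟨Sum.inr (Sum.inr ⟨0, hk⟩)⟩
  set z := recFactor β γ s x with hzdef
  have hcard : Fintype.card (Fin s.1 ⊕ Fin s.2.1 ⊕ Fin s.2.2) = s.1 + s.2.1 + s.2.2 := by
    simp [add_assoc]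
  have hz : ∀ i, 0 < z i := forall_recFactor hs (fun h => lt_of_le_of_ne hβ h.symm)
    (inv_pos.mpr hγ) fun i => by have := hx i; positivity
  have hzβ : ∀ i, β ≤ z i := forall_recFactor hs (fun _ => le_rfl)
    (by rw [← one_div, le_div_iff₀ hγ]; exact hβγ.le) fun i => le_ratio hγ hβγ (hx i).le
  have hzγ : ∀ i, γ * z i ≤ 1 := forall_recFactor (p := fun t => γ * t ≤ 1) hs
    (fun _ => by linarith) (mul_inv_cancel₀ hγ.ne').le fun i => by
      rw [← le_div_iff₀' hγ, one_div]; exact ratio_le hγ hβγ (hx i).le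
  have hF0 : 0 < F := by
    rw [← hF, frecR_eq_mul_prod]
    exact mul_pos hlam (prod_pos fun i _ => hz i)
  obtain ⟨Z, hZ, hZprod, hZβ, hZγ, hZle⟩ := exists_geomMean_sum_sqrt_sq_le hβ hγ hz hzβ hzγ
  rw [hcard] at hZprod hZle
  have hFZ : F = lam * Z ^ (s.1 + s.2.1 + s.2.2) := by
    rw [← hF, frecR_eq_mul_prod, hZprod]
  have hsum : ∑ i, (1 - β * γ) * √(x i / ((β * x i + 1) * (x i + γ))) ≤
      ∑ i, √((1 - γ * z i) * (1 - β / z i)) := by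
    rw [Fintype.sum_sum_type, Fintype.sum_sum_type]
    have heq : ∀ i, (1 - β * γ) * √(x i / ((β * x i + 1) * (x i + γ))) =
        √((1 - γ * z (Sum.inr (Sum.inr i))) * (1 - β / z (Sum.inr (Sum.inr i)))) := by
      intro i
      have := hx i
      rw [← Real.sqrt_sq hK.le, ← Real.sqrt_mul (sq_nonneg _)]
      congr 1
      simp only [hzdef, recFactor, Sum.elim_inr]
      field_simp
      ring
    simp only [heq]
    have h1 : 0 ≤ ∑ i, √((1 - γ * z (Sum.inl i)) * (1 - β / z (Sum.inl i))) :=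
      sum_nonneg fun i _ => Real.sqrt_nonneg _
    have h2 : 0 ≤ ∑ i, √((1 - γ * z (Sum.inr (Sum.inl i))) * (1 - β / z (Sum.inr (Sum.inl i)))) :=
      sum_nonneg fun i _ => Real.sqrt_nonneg _
    linarith
  have hsum0 : 0 ≤ ∑ i, (1 - β * γ) * √(x i / ((β * x i + 1) * (x i + γ))) :=
    sum_nonneg fun i _ => by positivity
  have hW : ((s.1 + s.2.1 + s.2.2 : ℕ) : ℝ) ^ 2 * ((1 - γ * Z) * (1 - β / Z)) *
      (F / ((β * F + 1) * (F + γ))) ≤ c := by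
    rcases hZβ.eq_or_lt with h | h
    · simp [← h, div_self (h ▸ hZ.ne' : β ≠ 0), hc0.le]
    rcases hZγ.eq_or_lt with h' | h'
    · simp [h', hc0.le]
    have h1 : 0 < Z - β := by linarith
    have h2 : 0 < 1 - γ * Z := by linarith
    have hratio : (β * ((1 - γ * Z) / (Z - β)) + 1) / ((1 - γ * Z) / (Z - β) + γ) = Z := by
      have h3 : (1 - γ * Z) / (Z - β) + γ = (1 - β * γ) / (Z - β) := by field_simp; ring
      have h4 : β * ((1 - γ * Z) / (Z - β)) + 1 = Z * (1 - β * γ) / (Z - β) := by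
        field_simp; ring
      rw [h3, h4]
      field_simp
    have hX : 0 < (1 - γ * Z) / (Z - β) := div_pos h2 h1
    have key := sq_mul_le_of_fixedPoint_slope_le (y := F) hβ hγ hlam hβγ
      (show 1 ≤ s.1 + s.2.1 + s.2.2 by omega) hc0 hc1 (hfix _ (by omega) hsΔ) hX
      (by rw [hratio, hFZ])
    refine le_of_eq_of_le ?_ key
    rw [mul_assoc]
    congr 2
    generalize hXX : (1 - γ * Z) / (Z - β) = X at hX hratio
    rw [← hratio]
    field_simp
    ring
  refine Real.le_sqrt_of_sq_le ?_
  have hFF : 0 ≤ F / ((β * F + 1) * (F + γ)) := by positivity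
  rw [mul_pow, Real.sq_sqrt hFF]
  exact (mul_le_mul_of_nonneg_right ((pow_le_pow_left₀ hsum0 hsum 2).trans hZle) hFF).trans hW

/-- An analytic antiderivative of `x ↦ 1/√(x(βx+1)(x+γ))` on an interval `(0, 2R)`. -/
lemma exists_analytic_potential {β γ : ℝ} (hβ : 0 ≤ β) (hγ : 0 < γ) (R : ℝ) :
    ∃ φ : ℝ → ℝ, ∀ x ∈ Set.Ioo 0 (2 * R), AnalyticAt ℝ φ x ∧
      HasDerivAt φ (√(x * ((β * x + 1) * (x + γ))))⁻¹ x := by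
  have hre : ∀ z ∈ Metric.ball (R : ℂ) R, 0 < z.re := by
    intro z hz
    have h1 := (Complex.abs_re_le_norm (z - R)).trans_lt (mem_ball_iff_norm.mp hz)
    have h2 := (abs_lt.mp h1).1
    simp only [Complex.sub_re, Complex.ofReal_re] at h2
    linarith
  set ρ : ℂ → ℂ := fun z =>
    Complex.exp (-((Complex.log z + (Complex.log (β * z + 1) + Complex.log (z + γ))) / 2)) with hρ
  have hdiff : DifferentiableOn ℂ ρ (Metric.ball (R : ℂ) R) := by
    intro z hz
    have h0 := hre z hz
    refine DifferentiableAt.differentiableWithinAt ?_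
    have h1 : z ∈ Complex.slitPlane := Or.inl h0
    have h2 : (β * z + 1 : ℂ) ∈ Complex.slitPlane := Or.inl (by simp; positivity)
    have h3 : (z + γ : ℂ) ∈ Complex.slitPlane := Or.inl (by simp; positivity)
    refine DifferentiableAt.cexp (DifferentiableAt.neg (DifferentiableAt.div_const ?_ 2))
    exact (differentiableAt_id.clog h1).add (DifferentiableAt.add
      (DifferentiableAt.clog (by fun_prop) h2) (DifferentiableAt.clog (by fun_prop) h3))
  obtain ⟨Φ, hΦ⟩ := hdiff.isExactOn_ball
  refine ⟨fun x => (Φ x).re, fun x hx => ?_⟩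
  have hxR : (x : ℂ) ∈ Metric.ball (R : ℂ) R := by
    rw [mem_ball_iff_norm, ← Complex.ofReal_sub, Complex.norm_real, Real.norm_eq_abs, abs_lt]
    constructor <;> linarith [hx.1, hx.2]
  have hx0 := hx.1
  refine ⟨AnalyticAt.re_ofReal ?_, ?_⟩
  · exact DifferentiableOn.analyticAt (s := Metric.ball (R : ℂ) R)
      (fun z hz => (hΦ z hz).differentiableAt.differentiableWithinAt)
      (Metric.isOpen_ball.mem_nhds hxR)
  · convert (hΦ x hxR).real_of_complex using 1
    have hcast : ρ x = ((Real.exp (-((Real.log x + (Real.log (β * x + 1) +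
        Real.log (x + γ))) / 2)) : ℝ) : ℂ) := by
      simp only [hρ]
      push_cast [Complex.ofReal_log hx0.le,
        Complex.ofReal_log (show (0 : ℝ) ≤ β * x + 1 by positivity),
        Complex.ofReal_log (show (0 : ℝ) ≤ x + γ by positivity)]
      rfl
    rw [hcast, Complex.ofReal_re, Real.exp_neg, Real.exp_half, Real.exp_add, Real.exp_add,
      Real.exp_log hx0, Real.exp_log (by positivity), Real.exp_log (by positivity)]

/-- The recursion functions map a compact interval of positive reals to itself. -/
lemma exists_interval_mapsTo_frecR {β γ lam : ℝ} (hβ : 0 ≤ β) (hγ : 0 < γ) (hlam : 0 < lam)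
    (hβγ : β * γ < 1) (n : ℕ) :
    ∃ a b : ℝ, 0 < a ∧ ∀ s : ℕ × ℕ × ℕ, (β = 0 → s.1 = 0) → s.1 + s.2.1 + s.2.2 ≤ n →
      ∀ x : Fin s.2.2 → ℝ, (∀ i, x i ∈ Set.Icc a b) →
        FrecR (β, γ, lam) s x ∈ Set.Icc a b := by
  set M : ℝ := max 1 γ⁻¹ with hM
  have hM1 : 1 ≤ M := le_max_left _ _
  set b : ℝ := lam * M ^ n with hb
  have hb0 : 0 < b := by positivity
  obtain ⟨m, hm0, hm1, hmβ, hmγ, hmx⟩ : ∃ m : ℝ, 0 < m ∧ m ≤ 1 ∧ (β ≠ 0 → m ≤ β) ∧ m ≤ γ⁻¹ ∧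
      ∀ x, 0 ≤ x → x ≤ b → m ≤ (β * x + 1) / (x + γ) := by
    rcases hβ.eq_or_lt with rfl | hβ0
    · refine ⟨min 1 (1 / (b + γ)), by positivity, min_le_left _ _, by simp, ?_, ?_⟩
      · refine (min_le_right _ _).trans ?_
        rw [← one_div]
        exact one_div_le_one_div_of_le hγ (by linarith)
      · intro x hx0 hxb
        refine (min_le_right _ _).trans ?_
        rw [zero_mul, zero_add]
        gcongr
    · refine ⟨min 1 β, by positivity, min_le_left _ _, fun _ => min_le_right _ _, ?_, ?_⟩
      · refine (min_le_right _ _).trans ?_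
        rw [← one_div, le_div_iff₀ hγ]
        exact hβγ.le
      · exact fun x hx _ => (min_le_right _ _).trans (le_ratio hγ hβγ hx)
  have ha : 0 < lam * m ^ n := by positivity
  refine ⟨lam * m ^ n, b, ha, fun s hs hsn x hx => ?_⟩
  have hx0 : ∀ i, 0 ≤ x i := fun i => ha.le.trans (hx i).1
  have hcard : #(univ : Finset (Fin s.1 ⊕ Fin s.2.1 ⊕ Fin s.2.2)) = s.1 + s.2.1 + s.2.2 := by
    simp [add_assoc]
  have hlow : ∀ i, m ≤ recFactor β γ s x i :=
    forall_recFactor hs hmβ hmγ fun i => hmx _ (hx0 i) (hx i).2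
  have hγM : γ⁻¹ ≤ M := le_max_right _ _
  have hhigh : ∀ i, recFactor β γ s x i ≤ M := by
    refine forall_recFactor (p := fun t => t ≤ M) hs (fun _ => le_trans ?_ hγM) hγM
      fun i => (ratio_le hγ hβγ (hx0 i)).trans hγM
    rw [← one_div, le_div_iff₀ hγ]
    exact hβγ.le
  rw [frecR_eq_mul_prod]
  constructor
  · refine mul_le_mul_of_nonneg_left ?_ hlam.le
    calc m ^ n ≤ m ^ (s.1 + s.2.1 + s.2.2) := pow_le_pow_of_le_one hm0.le hm1 hsn
      _ = ∏ _i : Fin s.1 ⊕ Fin s.2.1 ⊕ Fin s.2.2, m := by rw [prod_const, hcard]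
      _ ≤ _ := prod_le_prod (fun _ _ => hm0.le) fun i _ => hlow i
  · refine mul_le_mul_of_nonneg_left ?_ hlam.le
    calc _ ≤ ∏ _i : Fin s.1 ⊕ Fin s.2.1 ⊕ Fin s.2.2, M :=
          prod_le_prod (fun i _ => hm0.le.trans (hlow i)) fun i _ => hhigh i
      _ = M ^ (s.1 + s.2.1 + s.2.2) := by rw [prod_const, hcard]
      _ ≤ M ^ n := pow_le_pow_right₀ hM1 hsn

lemma hasDerivAt_frecR_update {β γ lam : ℝ} (hβ : 0 ≤ β) (hγ : 0 < γ) (s : ℕ × ℕ × ℕ)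
    (p : Fin s.2.2 → ℝ) (i : Fin s.2.2) (hp : 0 < p i) :
    HasDerivAt (fun t => FrecR (β, γ, lam) s (Function.update p i t))
      (-(FrecR (β, γ, lam) s p * (1 - β * γ) / ((β * p i + 1) * (p i + γ)))) (p i) := by
  set C : ℝ := lam * β ^ s.1 * γ⁻¹ ^ s.2.1 * ∏ j ∈ univ.erase i, (β * p j + 1) / (p j + γ)
  have hC : ∀ t, FrecR (β, γ, lam) s (Function.update p i t) = C * ((β * t + 1) / (t + γ)) := by
    intro t
    have : ∏ j ∈ univ.erase i, (β * Function.update p i t j + 1) / (Function.update p i t j + γ) =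
        ∏ j ∈ univ.erase i, (β * p j + 1) / (p j + γ) :=
      prod_congr rfl fun j hj => by rw [Function.update_of_ne (ne_of_mem_erase hj)]
    simp only [FrecR, C]
    rw [← mul_prod_erase univ _ (mem_univ i), this, Function.update_self]
    ring
  have hCp : FrecR (β, γ, lam) s p = C * ((β * p i + 1) / (p i + γ)) := by
    rw [← hC, Function.update_eq_self]
  simp only [hC, hCp]
  have h1 : HasDerivAt (fun t : ℝ => β * t + 1) β (p i) := by
    simpa using ((hasDerivAt_id (p i)).const_mul β).add_const 1
  have h2 : HasDerivAt (fun t : ℝ => t + γ) 1 (p i) := (hasDerivAt_id (p i)).add_const γ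
  refine ((h1.div h2 (by positivity)).const_mul C).congr_deriv ?_
  field_simp
  ring

/-- For `λ = 0` all recursion functions vanish. -/
lemma realContractionRestr_of_lam_eq_zero {Δ : ℕ} {β γ : ℝ} (hγ : 0 < γ) :
    RealContractionRestr (β, γ, 0) Δ := by
  have hF : ∀ s x, FrecR (β, γ, 0) s x = 0 := fun s x => by simp [FrecR]
  refine ⟨0, 0, id, id, 1, le_rfl, by simp, by simp [hγ.ne'], by simp, ?_, ?_, ?_, ?_, ?_, ?_,
    one_pos, ?_⟩
  · exact fun x _ => analyticAt_id
  · simp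
  · simp
  · simp
  · simp [hF]
  · simp [hF]
  · simp [hF]

/-- For `λ > 0`, slopes at most `c < 1` at the fixed points give real contraction. -/
lemma realContractionRestr_of_lam_pos {Δ : ℕ} {β γ lam c : ℝ} (hβ : 0 ≤ β) (hγ : 0 < γ)
    (hlam : 0 < lam) (hβγ : β * γ < 1) (hc0 : 0 < c) (hc1 : c < 1)
    (hfix : ∀ d : ℕ, 1 ≤ d → d ≤ Δ - 1 →
      ∀ x : ℝ, 0 < x → lam * ((β * x + 1) / (x + γ)) ^ d = x →
        (d : ℝ) * (1 - β * γ) * x / ((β * x + 1) * (x + γ)) ≤ c) :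
    RealContractionRestr (β, γ, lam) Δ := by
  obtain ⟨a, b, ha, hmaps⟩ := exists_interval_mapsTo_frecR hβ hγ hlam hβγ (Δ - 1)
  have hlammem : lam ∈ Set.Icc a b := by
    have := hmaps (0, 0, 0) (by simp) (by simp) Fin.elim0 (fun i => i.elim0)
    simpa [FrecR] using this
  have hK : 0 < 1 - β * γ := by linarith
  obtain ⟨φ, hφ⟩ := exists_analytic_potential hβ hγ (b + 1)
  have hsub : Set.Icc a b ⊆ Set.Ioo 0 (2 * (b + 1)) := fun x hx =>
    ⟨ha.trans_le hx.1, by linarith [hx.1, hx.2]⟩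
  have hφpos : ∀ {x : ℝ}, 0 < x → 0 < (√(x * ((β * x + 1) * (x + γ))))⁻¹ := fun hx => by
    positivity
  have hinj : Set.InjOn φ (Set.Ioo 0 (2 * (b + 1))) :=
    (strictMonoOn_of_deriv_pos (convex_Ioo _ _)
      (fun x hx => (hφ x hx).2.continuousAt.continuousWithinAt)
      (fun x hx => by
        rw [interior_Ioo] at hx
        rw [(hφ x hx).2.deriv]
        exact hφpos hx.1)).injOn
  set ψ := Function.invFunOn φ (Set.Ioo 0 (2 * (b + 1)))
  have hψ : ∀ x ∈ Set.Ioo 0 (2 * (b + 1)), ψ (φ x) = x := hinj.leftInvOn_invFunOn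
  have hψ' : ∀ x ∈ Set.Ioo 0 (2 * (b + 1)),
      HasDerivAt ψ (√(x * ((β * x + 1) * (x + γ)))) (φ x) := by
    intro x hx
    have hstrict : HasStrictDerivAt φ (√(x * ((β * x + 1) * (x + γ))))⁻¹ x := by
      rw [← (hφ x hx).2.deriv]
      exact (hφ x hx).1.hasStrictDerivAt
    have := hstrict.to_local_left_inverse (hφpos hx.1).ne'
      (Filter.mem_of_superset (isOpen_Ioo.mem_nhds hx) hψ)
    rw [inv_inv] at this
    exact this.hasDerivAt
  have hsqrt : √c < 1 := (Real.sqrt_lt' one_pos).mpr (by simpa using hc1)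
  refine ⟨a, b, φ, ψ, 1 - √c, hlammem.1.trans hlammem.2, hlammem, ?_, ?_,
    fun x hx => (hφ x (hsub hx)).1, ?_, fun x hx => hψ x (hsub hx), ?_, hmaps, ?_,
    by linarith, ?_⟩
  · exact fun h => by have := h.1; simp only at this; linarith
  · exact fun h => by linarith [h.1]
  · intro x hx
    rw [(hφ x (hsub hx)).2.deriv]
    exact (hφpos (hsub hx).1).ne'
  · rintro _ ⟨x, hx, rfl⟩
    rw [hψ x (hsub hx)]
  · intro s hs _ x hx h
    have hx0 : ∀ i, 0 < x i := fun i => ha.trans_le (hx i).1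
    have : 0 ≤ FrecR (β, γ, lam) s x := by
      rw [frecR_eq_mul_prod]
      refine mul_nonneg hlam.le (prod_nonneg fun i _ => ?_)
      exact forall_recFactor (p := fun t => 0 ≤ t) hs (fun _ => hβ) (inv_pos.mpr hγ).le
        (fun i => by have := hx0 i; positivity) i
    linarith
  · intro s hs hsΔ y hy
    choose p hp hpy using hy
    obtain rfl : y = fun i => φ (p i) := funext fun i => (hpy i).symm
    have hp0 : ∀ i, 0 < p i := fun i => ha.trans_le (hp i).1
    have hFmem := hmaps s hs hsΔ p hp
    generalize hF : FrecR (β, γ, lam) s p = F at hFmem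
    have hF0 : 0 < F := ha.trans_le hFmem.1
    have hderiv : ∀ i, |deriv (fun t => φ (FrecR (β, γ, lam) s fun j =>
        ψ (Function.update (fun i => φ (p i)) i t j))) (φ (p i))| =
        (1 - β * γ) * √(p i / ((β * p i + 1) * (p i + γ))) *
          √(F / ((β * F + 1) * (F + γ))) := by
      intro i
      have hpi := hp0 i
      have hfun : (fun t => φ (FrecR (β, γ, lam) s fun j =>
          ψ (Function.update (fun i => φ (p i)) i t j))) =
          fun t => φ (FrecR (β, γ, lam) s (Function.update p i (ψ t))) := by
        funext t
        congr 2
        funext j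
        rcases eq_or_ne j i with rfl | hj
        · simp
        · rw [Function.update_of_ne hj, Function.update_of_ne hj, hψ _ (hsub (hp j))]
      have h1 := hψ' (p i) (hsub (hp i))
      have h2 := hasDerivAt_frecR_update (lam := lam) hβ hγ s p i hpi
      have h3 := (hφ F (hsub hFmem)).2
      rw [← hψ (p i) (hsub (hp i))] at h2
      have h4 := h2.comp (φ (p i)) h1
      have h5 := HasDerivAt.comp (h₂ := φ) (φ (p i))
        (by simpa [hψ (p i) (hsub (hp i)), hF] using h3) h4
      rw [hfun]
      have h6 := h5.deriv
      simp only [Function.comp_def, hψ (p i) (hsub (hp i)), hF] at h6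
      rw [h6]
      have e1 : √(p i / ((β * p i + 1) * (p i + γ))) =
          √(p i * ((β * p i + 1) * (p i + γ))) / ((β * p i + 1) * (p i + γ)) := by
        rw [eq_div_iff (by positivity), ← Real.sqrt_sq (show 0 ≤ (β * p i + 1) * (p i + γ) by
          positivity), ← Real.sqrt_mul (by positivity), Real.sqrt_sq (by positivity)]
        congr 1
        field_simp
      have e2 : √(F / ((β * F + 1) * (F + γ))) = F / √(F * ((β * F + 1) * (F + γ))) := by
        rw [eq_div_iff (by positivity), ← Real.sqrt_mul (by positivity)]
        rw [show F / ((β * F + 1) * (F + γ)) * (F * ((β * F + 1) * (F + γ))) = F ^ 2 by field_simp,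
          Real.sqrt_sq hF0.le]
      rw [e1, e2, neg_mul, mul_neg, abs_neg, abs_of_nonneg (by positivity)]
      field_simp
    simp only [hderiv]
    rw [← sum_mul, sub_sub_cancel]
    exact sum_sqrt_mul_sqrt_frecR_le hβ hγ hlam hβγ hc0 hc1 hfix hs hsΔ hp0 hF

/-- For `Δ ≥ 3`, every `ζ = (β, γ, λ) ∈ ℝ³` with `βγ < 1`, `β ≥ 0`,
`γ > 0`, `λ ≥ 0` that is up-to-`Δ` unique satisfies real contraction for `Δ`
(when `β = 0`, the contraction conditions are required only for recursion functions
`F_{ζ,s}` with `s₁ = 0`). -/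
theorem S2_realContraction (Δ : ℕ) (hΔ : 3 ≤ Δ) (β γ lam : ℝ)
    (hβ : 0 ≤ β) (hγ : 0 < γ) (hlam : 0 ≤ lam) (hβγ : β * γ < 1)
    (huniq : UpToUnique (β, γ, lam) Δ) :
    RealContractionRestr (β, γ, lam) Δ := by
  rcases huniq with h | ⟨h, c, hc0, hc1, hfix⟩
  · obtain rfl : lam = 0 := h
    exact realContractionRestr_of_lam_eq_zero hγ
  · exact realContractionRestr_of_lam_pos hβ hγ h hβγ hc0 hc1 hfix
end
end

section
/- Let β, γ, λ > 0 be real, Δ ≥ 1 an integer, r = min{1, β, 1/γ} and t = max{1, β, 1/γ}. Then for every s = (s₁, s₂, k) ∈ ℕ³ with s₁ + s₂ + k ≤ Δ − 1 and all x₁, …, x_k ∈ [λ·r^{Δ−1}, λ·t^{Δ−1}], the value F_{ζ,s}(x₁,…,x_k) = λ·β^{s₁}·γ^{−s₂}·∏_{i=1}^{k} (βx_i+1)/(x_i+γ) lies in [λ·r^{Δ−1}, λ·t^{Δ−1}]. -/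
open scoped Classical
open Finset

noncomputable section

theorem min_le_mobius_ratio {β γ y : ℝ} (hγ : 0 < γ) (hy : 0 < y) :
    min β γ⁻¹ ≤ (β * y + 1) / (y + γ) := by
  have h₁ : min β γ⁻¹ * y ≤ β * y := mul_le_mul_of_nonneg_right (min_le_left _ _) hy.le
  have h₂ : min β γ⁻¹ * γ ≤ γ⁻¹ * γ := mul_le_mul_of_nonneg_right (min_le_right _ _) hγ.le
  rw [inv_mul_cancel₀ hγ.ne'] at h₂
  rw [le_div_iff₀ (by positivity)]
  linarith

theorem mobius_ratio_le_max {β γ y : ℝ} (hγ : 0 < γ) (hy : 0 < y) :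
    (β * y + 1) / (y + γ) ≤ max β γ⁻¹ := by
  have h₁ : β * y ≤ max β γ⁻¹ * y := mul_le_mul_of_nonneg_right (le_max_left _ _) hy.le
  have h₂ : γ⁻¹ * γ ≤ max β γ⁻¹ * γ := mul_le_mul_of_nonneg_right (le_max_right _ _) hγ.le
  rw [inv_mul_cancel₀ hγ.ne'] at h₂
  rw [div_le_iff₀ (by positivity)]
  linarith

/-- For `β, γ, λ > 0`, `Δ ≥ 1`, `r = min{1, β, 1/γ}` and
`t = max{1, β, 1/γ}`, the interval `[λ·r^{Δ−1}, λ·t^{Δ−1}]` is invariant under every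
recursion function `F_{ζ,s}` with `‖s‖₁ ≤ Δ − 1`. -/
theorem invariant_interval (β γ lam : ℝ) (hβ : 0 < β) (hγ : 0 < γ) (hlam : 0 < lam)
    (Δ : ℕ) (hΔ : 1 ≤ Δ) (s : ℕ × ℕ × ℕ) (hs : s.1 + s.2.1 + s.2.2 ≤ Δ - 1)
    (x : Fin s.2.2 → ℝ)
    (hx : ∀ i, x i ∈ Set.Icc (lam * (min 1 (min β γ⁻¹)) ^ (Δ - 1))
                             (lam * (max 1 (max β γ⁻¹)) ^ (Δ - 1))) :
    FrecR (β, γ, lam) s x ∈ Set.Icc (lam * (min 1 (min β γ⁻¹)) ^ (Δ - 1))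
                                    (lam * (max 1 (max β γ⁻¹)) ^ (Δ - 1)) := by
  set r := min 1 (min β γ⁻¹)
  set t := max 1 (max β γ⁻¹)
  have hr0 : 0 < r := by positivity
  have hr1 : r ≤ 1 := min_le_left _ _
  have ht1 : 1 ≤ t := le_max_left _ _
  have hrβ : r ≤ β := (min_le_right _ _).trans (min_le_left _ _)
  have hrγ : r ≤ γ⁻¹ := (min_le_right _ _).trans (min_le_right _ _)
  have hβt : β ≤ t := (le_max_left _ _).trans (le_max_right _ _)
  have hγt : γ⁻¹ ≤ t := (le_max_right _ _).trans (le_max_right _ _)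
  have hx0 (i) : 0 < x i := lt_of_lt_of_le (by positivity) (hx i).1
  have hlow : r ^ s.2.2 ≤ ∏ i, (β * x i + 1) / (x i + γ) := by
    simpa using Finset.prod_le_prod (s := Finset.univ) (f := fun _ : Fin s.2.2 => r)
      (fun _ _ => hr0.le)
      (fun i _ => (min_le_right _ _).trans (min_le_mobius_ratio (β := β) hγ (hx0 i)))
  have hupp : ∏ i, (β * x i + 1) / (x i + γ) ≤ t ^ s.2.2 := by
    simpa using Finset.prod_le_prod (s := Finset.univ) (g := fun _ : Fin s.2.2 => t)
      (fun i _ => (lt_min hβ (inv_pos.2 hγ)).le.trans (min_le_mobius_ratio hγ (hx0 i)))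
      (fun i _ => (mobius_ratio_le_max (β := β) hγ (hx0 i)).trans (le_max_right _ _))
  have hprod : 0 ≤ ∏ i, (β * x i + 1) / (x i + γ) := (pow_nonneg hr0.le _).trans hlow
  simp only [FrecR, Set.mem_Icc, mul_assoc]
  constructor
  · gcongr
    calc r ^ (Δ - 1) ≤ r ^ (s.1 + s.2.1 + s.2.2) := pow_le_pow_of_le_one hr0.le hr1 hs
      _ = r ^ s.1 * (r ^ s.2.1 * r ^ s.2.2) := by ring
      _ ≤ _ := by gcongr
  · gcongr
    calc β ^ s.1 * (γ⁻¹ ^ s.2.1 * ∏ i, (β * x i + 1) / (x i + γ))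
        ≤ t ^ s.1 * (t ^ s.2.1 * t ^ s.2.2) := by gcongr
      _ = t ^ (s.1 + s.2.1 + s.2.2) := by ring
      _ ≤ t ^ (Δ - 1) := pow_le_pow_right₀ ht1 hs
end
end

section
/- Let Δ ≥ 3 be an integer and let β, γ > 0 be real numbers with (Δ−2)/Δ < √(βγ) < Δ/(Δ−2). Then for every real x, |1 − βγ| / (β·e^x + γ·e^{−x} + 1 + βγ) ≤ |1 − √(βγ)| / (1 + √(βγ)) < 1/(Δ−1). -/
/-- For an integer `Δ ≥ 3` and reals `β, γ > 0` with
`(Δ−2)/Δ < √(βγ) < Δ/(Δ−2)`, we have for every real `x`: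
`|1 − βγ|/(β·e^x + γ·e^{−x} + 1 + βγ) ≤ |1 − √(βγ)|/(1 + √(βγ)) < 1/(Δ−1)`. -/
theorem gradient_bound_S1 (Δ : ℕ) (hΔ : 3 ≤ Δ) (β γ : ℝ) (hβ : 0 < β) (hγ : 0 < γ)
    (h1 : ((Δ:ℝ) - 2) / (Δ:ℝ) < Real.sqrt (β * γ))
    (h2 : Real.sqrt (β * γ) < (Δ:ℝ) / ((Δ:ℝ) - 2)) (x : ℝ) :
    |1 - β * γ| / (β * Real.exp x + γ * Real.exp (-x) + 1 + β * γ)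
        ≤ |1 - Real.sqrt (β * γ)| / (1 + Real.sqrt (β * γ)) ∧
    |1 - Real.sqrt (β * γ)| / (1 + Real.sqrt (β * γ)) < 1 / ((Δ:ℝ) - 1) := by
  have hD : (3:ℝ) ≤ Δ := by exact_mod_cast hΔ
  have hs : 0 < Real.sqrt (β * γ) := Real.sqrt_pos.2 (mul_pos hβ hγ)
  have hsq : Real.sqrt (β * γ) ^ 2 = β * γ := Real.sq_sqrt (mul_pos hβ hγ).le
  have hab : (β * Real.exp x) * (γ * Real.exp (-x)) = β * γ := by
    rw [mul_mul_mul_comm, ← Real.exp_add, add_neg_cancel, Real.exp_zero, mul_one]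
  have ha : 0 < β * Real.exp x := by positivity
  have hb : 0 < γ * Real.exp (-x) := by positivity
  rw [div_lt_iff₀ (by linarith)] at h1
  rw [lt_div_iff₀ (by linarith)] at h2
  generalize Real.sqrt (β * γ) = s at *
  rw [← hsq] at hab ⊢
  generalize β * Real.exp x = a at *
  generalize γ * Real.exp (-x) = b at *
  have amgm : 2 * s ≤ a + b :=
    abs_le_of_sq_le_sq' (by nlinarith [sq_nonneg (a - b)]) (by linarith) |>.2
  have hfactor : |1 - s ^ 2| = |1 - s| * (1 + s) := by
    rw [show 1 - s ^ 2 = (1 - s) * (1 + s) by ring, abs_mul, abs_of_pos (by linarith : 0 < 1 + s)]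
  constructor
  · rw [hfactor, div_le_div_iff₀ (by positivity) (by linarith), mul_assoc]
    exact mul_le_mul_of_nonneg_left (by nlinarith) (abs_nonneg _)
  · rw [div_lt_div_iff₀ (by linarith) (by linarith)]
    rcases abs_cases (1 - s) with ⟨h, -⟩ | ⟨h, -⟩ <;> rw [h] <;> linarith
end

section
/- Let Δ ≥ 3 be an integer, let β, γ > 0 be real with βγ > Δ/(Δ−2), let t = max{1, β}, and let λ be real with 0 < λ < γ/(t^{Δ−1}·((Δ−2)βγ−Δ)). Then for every real y with 0 < y ≤ λ·t^{Δ−1}, (βγ − 1) / (β·y + γ/y + 1 + βγ) < 1/(Δ−1). -/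
/-- For an integer `Δ ≥ 3`, reals `β, γ > 0` with `βγ > Δ/(Δ−2)`,
`t = max{1, β}`, and `0 < λ < γ/(t^{Δ−1}·((Δ−2)βγ−Δ))`, we have for every real `y`
with `0 < y ≤ λ·t^{Δ−1}`: `(βγ − 1)/(β·y + γ/y + 1 + βγ) < 1/(Δ−1)`. -/
theorem gradient_bound_S3 (Δ : ℕ) (hΔ : 3 ≤ Δ) (β γ lam : ℝ) (hβ : 0 < β) (hγ : 0 < γ)
    (hβγ : β * γ > (Δ:ℝ) / ((Δ:ℝ) - 2)) (hlam0 : 0 < lam)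
    (hlam : lam < γ / ((max 1 β) ^ (Δ - 1) * (((Δ:ℝ) - 2) * (β * γ) - (Δ:ℝ))))
    (y : ℝ) (hy0 : 0 < y) (hy : y ≤ lam * (max 1 β) ^ (Δ - 1)) :
    (β * γ - 1) / (β * y + γ / y + 1 + β * γ) < 1 / ((Δ:ℝ) - 1) := by
  have hΔ' : (3 : ℝ) ≤ Δ := by exact_mod_cast hΔ
  have hD : 0 < ((Δ : ℝ) - 2) * (β * γ) - Δ := by
    rw [gt_iff_lt, div_lt_iff₀ (by linarith)] at hβγ
    linarith
  have ht : 0 < (max 1 β) ^ (Δ - 1) := by positivity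
  have hγy : ((Δ : ℝ) - 2) * (β * γ) - Δ < γ / y := by
    rw [lt_div_iff₀ (mul_pos ht hD)] at hlam
    rw [lt_div_iff₀ hy0]
    calc (((Δ : ℝ) - 2) * (β * γ) - Δ) * y
        ≤ (((Δ : ℝ) - 2) * (β * γ) - Δ) * (lam * (max 1 β) ^ (Δ - 1)) := by gcongr
      _ = lam * ((max 1 β) ^ (Δ - 1) * (((Δ : ℝ) - 2) * (β * γ) - Δ)) := by ring
      _ < γ := hlam
  have hβy : 0 < β * y := mul_pos hβ hy0
  rw [div_lt_div_iff₀ (by positivity) (by linarith)]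
  linarith
end

section
/- Let Δ ≥ 3 be an integer, let β, γ > 0 be real with βγ > Δ/(Δ−2), let r = min{1, 1/γ}, and let λ be real with λ > ((Δ−2)βγ − Δ)/(β·r^{Δ−1}). Then for every real y with y ≥ λ·r^{Δ−1}, (βγ − 1) / (β·y + γ/y + 1 + βγ) < 1/(Δ−1). -/
/-- For an integer `Δ ≥ 3`, reals `β, γ > 0` with `βγ > Δ/(Δ−2)`,
`r = min{1, 1/γ}`, and `λ > ((Δ−2)βγ − Δ)/(β·r^{Δ−1})`, we have for every real `y`
with `y ≥ λ·r^{Δ−1}`: `(βγ − 1)/(β·y + γ/y + 1 + βγ) < 1/(Δ−1)`. -/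
theorem gradient_bound_S4 (Δ : ℕ) (hΔ : 3 ≤ Δ) (β γ lam : ℝ) (hβ : 0 < β) (hγ : 0 < γ)
    (hβγ : β * γ > (Δ:ℝ) / ((Δ:ℝ) - 2))
    (hlam : lam > (((Δ:ℝ) - 2) * (β * γ) - (Δ:ℝ)) / (β * (min 1 γ⁻¹) ^ (Δ - 1)))
    (y : ℝ) (hy : y ≥ lam * (min 1 γ⁻¹) ^ (Δ - 1)) :
    (β * γ - 1) / (β * y + γ / y + 1 + β * γ) < 1 / ((Δ:ℝ) - 1) := by
  have hΔ' : (3:ℝ) ≤ (Δ:ℝ) := by exact_mod_cast hΔ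
  have hr : 0 < (min 1 γ⁻¹) ^ (Δ - 1) := pow_pos (lt_min one_pos (inv_pos.2 hγ)) _
  have hpos : 0 < ((Δ:ℝ) - 2) * (β * γ) - (Δ:ℝ) := by
    have h := (div_lt_iff₀ (by linarith : (0:ℝ) < (Δ:ℝ) - 2)).1 hβγ
    linarith
  have hβy : ((Δ:ℝ) - 2) * (β * γ) - (Δ:ℝ) < β * y := by
    have h := (div_lt_iff₀ (mul_pos hβ hr)).1 hlam
    have h' := mul_le_mul_of_nonneg_left hy hβ.le
    linarith
  have hy0 : 0 < y := pos_of_mul_pos_right (hpos.trans hβy) hβ.le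
  have hγy : 0 < γ / y := div_pos hγ hy0
  have hβγ0 : 0 < β * γ := mul_pos hβ hγ
  rw [div_lt_div_iff₀ (by linarith) (by linarith)]
  linarith
end

section
/- Let β ≥ 0 and γ > 0 be real with βγ < 1, let d ≥ 1 be an integer, and let z₁, …, z_d ∈ (β, 1/γ). Set ẑ = (∏_{i=1}^{d} z_i)^{1/d}. Then Σ_{i=1}^{d} √((1/z_i − γ)(z_i − β)) ≤ d·√(1 + βγ − γ·ẑ − β/ẑ). -/
open Finset

/-- The equally weighted AM–GM inequality, with the mean cleared of its denominator. -/
lemma card_mul_prod_rpow_inv_le_sum {ι : Type*} [Fintype ι] [Nonempty ι] (f : ι → ℝ)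
    (hf : ∀ i, 0 ≤ f i) :
    (Fintype.card ι : ℝ) * (∏ i, f i) ^ ((Fintype.card ι : ℝ)⁻¹) ≤ ∑ i, f i := by
  have hcard : (0 : ℝ) < Fintype.card ι := by exact_mod_cast Fintype.card_pos
  have h := Real.geom_mean_le_arith_mean univ (fun _ ↦ (1 : ℝ)) f (fun _ _ ↦ zero_le_one)
    (by simpa using hcard) (fun i _ ↦ hf i)
  simp only [Real.rpow_one, sum_const, card_univ, nsmul_eq_mul, mul_one, one_mul] at h
  rwa [le_div_iff₀' hcard] at h

/-- Let `β ≥ 0`, `γ > 0` with `βγ < 1`, `d ≥ 1`, and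
`z₁, …, z_d ∈ (β, 1/γ)`. With `ẑ = (∏ᵢ zᵢ)^{1/d}` the geometric mean,
`Σᵢ √((1/zᵢ − γ)(zᵢ − β)) ≤ d·√(1 + βγ − γ·ẑ − β/ẑ)`. -/
theorem cauchy_schwarz_amgm_step (β γ : ℝ) (hβ : 0 ≤ β) (hγ : 0 < γ)
    (hβγ : β * γ < 1) (d : ℕ) (hd : 1 ≤ d) (z : Fin d → ℝ)
    (hz : ∀ i, z i ∈ Set.Ioo β γ⁻¹)
    (zhat : ℝ) (hzhat : zhat = (∏ i, z i) ^ ((d : ℝ)⁻¹)) :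
    ∑ i, Real.sqrt (((z i)⁻¹ - γ) * (z i - β))
      ≤ (d : ℝ) * Real.sqrt (1 + β * γ - γ * zhat - β / zhat) := by
  have : Nonempty (Fin d) := ⟨⟨0, hd⟩⟩
  have hpos : ∀ i, 0 < z i := fun i ↦ hβ.trans_lt (hz i).1
  have hnonneg : ∀ i, 0 ≤ ((z i)⁻¹ - γ) * (z i - β) := fun i ↦
    mul_nonneg (sub_nonneg.2 ((le_inv_comm₀ (hpos i) hγ).1 (hz i).2.le))
      (sub_nonneg.2 (hz i).1.le)
  have hmean : (d : ℝ) * zhat ≤ ∑ i, z i := by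
    simpa [hzhat] using card_mul_prod_rpow_inv_le_sum z fun i ↦ (hpos i).le
  have hmean_inv : (d : ℝ) * zhat⁻¹ ≤ ∑ i, (z i)⁻¹ := by
    have h := card_mul_prod_rpow_inv_le_sum (fun i ↦ (z i)⁻¹) fun i ↦ (inv_pos.2 (hpos i)).le
    rwa [prod_inv_distrib, Real.inv_rpow (prod_nonneg fun i _ ↦ (hpos i).le),
      Fintype.card_fin, ← hzhat] at h
  have hsum : ∑ i, ((z i)⁻¹ - γ) * (z i - β)
      = d * (1 + β * γ) - γ * ∑ i, z i - β * ∑ i, (z i)⁻¹ := by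
    have hterm : ∀ i, ((z i)⁻¹ - γ) * (z i - β) = 1 + β * γ - γ * z i - β * (z i)⁻¹ := by
      intro i
      have := (hpos i).ne'
      field_simp
      ring
    simp only [hterm, sum_sub_distrib, ← mul_sum, sum_const, card_univ, Fintype.card_fin,
      nsmul_eq_mul]
  have hle : ∑ i, ((z i)⁻¹ - γ) * (z i - β)
      ≤ d * (1 + β * γ - γ * zhat - β / zhat) := by
    rw [hsum, div_eq_mul_inv]
    linarith [mul_le_mul_of_nonneg_left hmean hγ.le, mul_le_mul_of_nonneg_left hmean_inv hβ]
  have hcs := sq_sum_le_card_mul_sum_sq (s := univ)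
    (f := fun i ↦ Real.sqrt (((z i)⁻¹ - γ) * (z i - β)))
  simp only [Real.sq_sqrt (hnonneg _), card_univ, Fintype.card_fin] at hcs
  have hd_nonneg : (0 : ℝ) ≤ d := d.cast_nonneg
  rw [← Real.sqrt_sq hd_nonneg, ← Real.sqrt_mul (sq_nonneg _)]
  refine Real.le_sqrt_of_sq_le (hcs.trans ?_)
  rw [sq, mul_assoc]
  exact mul_le_mul_of_nonneg_left hle hd_nonneg
end

section
/- Let β ≥ 0, γ > 0, λ > 0 be real with βγ < 1, let d ≥ 1 be an integer, and let f_d(x) = λ·((βx+1)/(x+γ))^d. Then the equation (γ − β·x²)/(d·(1−βγ)·x) = (γ − β·f_d(x)²)/((β·f_d(x)+1)·(f_d(x)+γ)) has exactly one solution x in (0, +∞). -/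
noncomputable section

/-- The function `f_d(x) = λ((βx+1)/(x+γ))^d`. -/
def fd (β γ lam : ℝ) (d : ℕ) (x : ℝ) : ℝ := lam * ((β * x + 1) / (x + γ)) ^ d

theorem fd_pos {β γ lam : ℝ} (hβ : 0 ≤ β) (hγ : 0 < γ) (hlam : 0 < lam) (d : ℕ) {x : ℝ}
    (hx : 0 ≤ x) : 0 < fd β γ lam d x := by
  unfold fd
  positivity

theorem fd_strictAntiOn {β γ lam : ℝ} (hβ : 0 ≤ β) (hγ : 0 < γ) (hlam : 0 < lam)
    (hβγ : β * γ < 1) {d : ℕ} (hd : d ≠ 0) : StrictAntiOn (fd β γ lam d) (Set.Ici 0) := by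
  intro a ha b hb hab
  rw [Set.mem_Ici] at ha hb
  unfold fd
  have h : (β * b + 1) / (b + γ) < (β * a + 1) / (a + γ) := by
    rw [div_lt_div_iff₀ (by positivity) (by positivity)]
    nlinarith [mul_pos (sub_pos.2 hab) (sub_pos.2 hβγ)]
  gcongr

theorem continuousOn_fd {β γ lam : ℝ} (hγ : 0 < γ) (d : ℕ) :
    ContinuousOn (fd β γ lam d) (Set.Ici 0) := by
  unfold fd
  refine continuousOn_const.mul
    (ContinuousOn.pow (ContinuousOn.div (by fun_prop) (by fun_prop) ?_) d)
  intro x hx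
  rw [Set.mem_Ici] at hx
  positivity

/-- The right-hand side of the critical-point equation, as a function of `y = f_d(x)`. -/
def criticalRatio (β γ y : ℝ) : ℝ := (γ - β * y ^ 2) / ((β * y + 1) * (y + γ))

theorem criticalRatio_strictAntiOn {β γ : ℝ} (hβ : 0 ≤ β) (hγ : 0 < γ) :
    StrictAntiOn (criticalRatio β γ) (Set.Ici 0) := by
  intro a ha b hb hab
  rw [Set.mem_Ici] at ha hb
  unfold criticalRatio
  rw [div_lt_div_iff₀ (by positivity) (by positivity), ← sub_pos]
  have hab' : 0 < b - a := sub_pos.2 hab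
  have h : 0 < (b - a) * (2 * γ * β * (b + a) + γ * (1 + β * γ) + β * (1 + β * γ) * (a * b)) := by
    positivity
  linarith

theorem criticalRatio_lt_one {β γ y : ℝ} (hβ : 0 ≤ β) (hγ : 0 < γ) (hy : 0 < y) :
    criticalRatio β γ y < 1 := by
  unfold criticalRatio
  rw [div_lt_one (by positivity)]
  have h : 0 < 2 * β * y ^ 2 + (1 + β * γ) * y := by positivity
  linarith

theorem neg_one_lt_criticalRatio {β γ y : ℝ} (hβ : 0 ≤ β) (hγ : 0 < γ) (hy : 0 < y) :
    -1 < criticalRatio β γ y := by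
  unfold criticalRatio
  rw [lt_div_iff₀ (by positivity)]
  have h : 0 < 2 * γ + (1 + β * γ) * y := by positivity
  linarith

theorem continuousOn_criticalRatio {β γ : ℝ} (hβ : 0 ≤ β) (hγ : 0 < γ) :
    ContinuousOn (criticalRatio β γ) (Set.Ici 0) := by
  refine ContinuousOn.div (by fun_prop) (by fun_prop) fun y hy => ?_
  rw [Set.mem_Ici] at hy
  positivity

theorem strictAntiOn_sub_mul_sq_div {β γ k : ℝ} (hβ : 0 ≤ β) (hγ : 0 < γ) (hk : 0 < k) :
    StrictAntiOn (fun x => (γ - β * x ^ 2) / (k * x)) (Set.Ioi 0) := by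
  intro a ha b hb hab
  rw [Set.mem_Ioi] at ha hb
  dsimp only
  rw [div_lt_div_iff₀ (by positivity) (by positivity), ← sub_pos]
  have hab' : 0 < b - a := sub_pos.2 hab
  have h : 0 < k * (b - a) * (γ + β * (a * b)) := by positivity
  linarith

theorem exists_one_le_sub_mul_sq_div {β γ k : ℝ} (hβ : 0 ≤ β) (hγ : 0 < γ) (hk : 0 < k) :
    ∃ x, 0 < x ∧ 1 ≤ (γ - β * x ^ 2) / (k * x) := by
  have hx : 0 < γ / (β + k + γ) := by positivity
  have hx1 : γ / (β + k + γ) ≤ 1 := by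
    rw [div_le_one (by positivity)]
    linarith
  have he : γ / (β + k + γ) * (β + k + γ) = γ := by field_simp
  generalize γ / (β + k + γ) = x at hx hx1 he
  refine ⟨x, hx, ?_⟩
  rw [le_div_iff₀ (by positivity)]
  nlinarith [mul_nonneg (mul_nonneg hβ hx.le) (sub_nonneg.2 hx1), mul_pos hγ hx]

theorem exists_sub_mul_sq_div_le_neg_one {β γ k : ℝ} (hβ : 0 < β) (hγ : 0 < γ) (hk : 0 < k) :
    ∃ x, 0 < x ∧ (γ - β * x ^ 2) / (k * x) ≤ -1 := by
  have hx1 : 1 ≤ 1 + (k + γ) / β := le_add_of_nonneg_right (by positivity)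
  have he : β * (1 + (k + γ) / β) = β + k + γ := by
    field_simp
    ring
  generalize 1 + (k + γ) / β = x at hx1 he
  have hx : 0 < x := by linarith
  refine ⟨x, hx, ?_⟩
  rw [div_le_iff₀ (by positivity)]
  have h : β * x ^ 2 = (β + k + γ) * x := by rw [← he]; ring
  nlinarith [mul_le_mul_of_nonneg_left hx1 hγ.le, mul_pos hβ hx]

theorem exists_sub_mul_sq_div_le_criticalRatio_fd {β γ lam k : ℝ} (hβ : 0 ≤ β) (hγ : 0 < γ)
    (hlam : 0 < lam) (hβγ : β * γ < 1) (hk : 0 < k) {d : ℕ} (hd : d ≠ 0) :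
    ∃ x, 0 < x ∧ (γ - β * x ^ 2) / (k * x) ≤ criticalRatio β γ (fd β γ lam d x) := by
  rcases hβ.eq_or_lt with rfl | hβ'
  · have hf0 := fd_pos le_rfl hγ hlam d le_rfl
    have hx : 0 < (fd 0 γ lam d 0 + γ) / k := by positivity
    refine ⟨_, hx, ?_⟩
    have hlt := fd_strictAntiOn le_rfl hγ hlam hβγ hd Set.self_mem_Ici hx.le hx
    have hpos := fd_pos le_rfl hγ hlam d hx.le
    rw [mul_div_cancel₀ _ hk.ne']
    simp only [criticalRatio, zero_mul, sub_zero, zero_add, one_mul]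
    gcongr
  · obtain ⟨x, hx, h⟩ := exists_sub_mul_sq_div_le_neg_one hβ' hγ hk
    exact ⟨x, hx, h.trans (neg_one_lt_criticalRatio hβ hγ (fd_pos hβ hγ hlam d hx.le)).le⟩

/-- Let `β ≥ 0`, `γ > 0`, `λ > 0` with `βγ < 1` and `d ≥ 1`. Then
the equation `(γ − βx²)/(d(1−βγ)x) = (γ − β f_d(x)²)/((β f_d(x)+1)(f_d(x)+γ))` has
exactly one solution `x ∈ (0, ∞)`. -/
theorem unique_critical_point (β γ lam : ℝ) (hβ : 0 ≤ β) (hγ : 0 < γ)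
    (hlam : 0 < lam) (hβγ : β * γ < 1) (d : ℕ) (hd : 1 ≤ d) :
    ∃! x : ℝ, 0 < x ∧
      (γ - β * x ^ 2) / ((d : ℝ) * (1 - β * γ) * x) =
        (γ - β * (fd β γ lam d x) ^ 2) /
          ((β * fd β γ lam d x + 1) * (fd β γ lam d x + γ)) := by
  have hd0 : d ≠ 0 := by lia
  have hk : 0 < (d : ℝ) * (1 - β * γ) :=
    mul_pos (by exact_mod_cast hd) (sub_pos.2 hβγ)
  have hfpos : ∀ x : ℝ, 0 < x → 0 < fd β γ lam d x := fun x hx => fd_pos hβ hγ hlam d hx.le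
  set L : ℝ → ℝ := fun x => (γ - β * x ^ 2) / ((d : ℝ) * (1 - β * γ) * x)
  set R : ℝ → ℝ := fun x => criticalRatio β γ (fd β γ lam d x)
  change ∃! x : ℝ, 0 < x ∧ L x = R x
  have hL : StrictAntiOn L (Set.Ioi 0) := strictAntiOn_sub_mul_sq_div hβ hγ hk
  have hR : StrictMonoOn R (Set.Ioi 0) := fun a ha b hb hab =>
    criticalRatio_strictAntiOn hβ hγ (hfpos b hb).le (hfpos a ha).le
      (fd_strictAntiOn hβ hγ hlam hβγ hd0 (Set.mem_Ioi.1 ha).le (Set.mem_Ioi.1 hb).le hab)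
  have hLc : ContinuousOn L (Set.Ioi 0) :=
    ContinuousOn.div (by fun_prop) (by fun_prop) fun x hx => (mul_pos hk hx).ne'
  have hRc : ContinuousOn R (Set.Ioi 0) :=
    (continuousOn_criticalRatio hβ hγ).comp
      ((continuousOn_fd hγ d).mono Set.Ioi_subset_Ici_self) fun x hx => (hfpos x hx).le
  obtain ⟨a, ha, hLa⟩ := exists_one_le_sub_mul_sq_div hβ hγ hk
  obtain ⟨b, hb, hLb⟩ := exists_sub_mul_sq_div_le_criticalRatio_fd hβ hγ hlam hβγ hk hd0
  have hRa : R a ≤ L a := (criticalRatio_lt_one hβ hγ (hfpos a ha)).le.trans hLa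
  obtain ⟨x, hx, hxe⟩ := isPreconnected_Ioi.intermediate_value₂ hb ha hLc hRc hLb hRa
  refine ⟨x, ⟨hx, hxe⟩, fun y ⟨hy, hye⟩ => ?_⟩
  rcases lt_trichotomy y x with h | h | h
  · linarith [hL hy hx h, hR hy hx h]
  · exact h
  · linarith [hL hx hy h, hR hx hy h]
end
end
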